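/- Let γ ⊂ ℙ² be an irreducible conic and let ℓ₁,…,ℓ_r, m₁,…,m_s be pairwise distinct lines all tangent to γ, with r, s ≥ 2. Let X = 𝕊(ℓ₁,…,ℓ_r) and Y = 𝕊(m₁,…,m_s) be the corresponding contact star configurations on γ. Let P, Q be any two distinct points of ℙ² and let Z = (r−1)P + (s−1)Q be the fat point scheme with ideal I_Z = I_P^{r−1} ∩ I_Q^{s−1}. Then h_{X∪Y}(d) = h_Z(d) for every integer d ≥ 0. -/

import Mathlib

open MvPolynomial

noncomputable section

abbrev P2 : Type := Projectivization ℂ (Fin 3 → ℂ)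

/-- A line in `ℙ²`: the zero locus of a nonzero linear form. -/
def IsLine (L : Set P2) : Prop :=
  ∃ a : Fin 3 → ℂ, a ≠ 0 ∧ L = {p : P2 | (∑ i, a i * p.rep i) = 0}

/-- An irreducible conic in `ℙ²`: the zero locus of an irreducible homogeneous quadratic form. -/
def IsIrredConic (γ : Set P2) : Prop :=
  ∃ q : MvPolynomial (Fin 3) ℂ, q.IsHomogeneous 2 ∧ Irreducible q ∧
    γ = {p : P2 | eval p.rep q = 0}

/-- `L` is tangent to `γ` : their intersection is a single point. -/
def IsTangent (L γ : Set P2) : Prop := ∃ p : P2, L ∩ γ = {p}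

/-- The star configuration defined by a family of lines: the set of points lying on at
least two of the lines. -/
def starConfig {r : ℕ} (L : Fin r → Set P2) : Set P2 :=
  {p : P2 | ∃ i j : Fin r, i ≠ j ∧ p ∈ L i ∧ p ∈ L j}

/-- A family of lines meets properly: they are distinct lines, no three concurrent. -/
def MeetsProperly {r : ℕ} (L : Fin r → Set P2) : Prop :=
  (∀ i, IsLine (L i)) ∧ Function.Injective L ∧
    ∀ (p : P2) (i j k : Fin r), p ∈ L i → p ∈ L j → p ∈ L k → i = j ∨ i = k ∨ j = k

/-- `W` is a complete intersection of type `(a,b)`. -/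
def IsCI (W : Set P2) (a b : ℕ) : Prop :=
  ∃ F G : MvPolynomial (Fin 3) ℂ, F ≠ 0 ∧ G ≠ 0 ∧
    F.IsHomogeneous a ∧ G.IsHomogeneous b ∧
    {p : P2 | eval p.rep F = 0 ∧ eval p.rep G = 0} = W ∧ W.ncard = a * b

/-- The `ℂ`-submodule of polynomials vanishing at every point of `W`. -/
def vanishingSubmodule (W : Set P2) : Submodule ℂ (MvPolynomial (Fin 3) ℂ) where
  carrier := {F : MvPolynomial (Fin 3) ℂ | ∀ p ∈ W, eval p.rep F = 0}
  add_mem' := by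
    intro a b ha hb p hp
    simp only [map_add, ha p hp, hb p hp, add_zero]
  zero_mem' := by
    intro p hp
    simp
  smul_mem' := by
    intro c F hF p hp
    simp only [smul_eval, hF p hp, mul_zero]

/-- The degree-`d` graded component of the vanishing ideal of `W`. -/
def idealComp (W : Set P2) (d : ℕ) : Submodule ℂ (MvPolynomial (Fin 3) ℂ) :=
  homogeneousSubmodule (Fin 3) ℂ d ⊓ vanishingSubmodule W

/-- The Hilbert function of `W ⊆ ℙ²`. -/
def HF (W : Set P2) (d : ℕ) : ℤ :=
  (Module.finrank ℂ ↥(homogeneousSubmodule (Fin 3) ℂ d) : ℤ) -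
    (Module.finrank ℂ ↥(idealComp W d) : ℤ)

/-- The h-vector of `W ⊆ ℙ²`. -/
def hvec (W : Set P2) : ℕ → ℤ
  | 0 => HF W 0
  | d + 1 => HF W (d + 1) - HF W d

/-- The (affine cone) ideal of a point of `ℙ²`; its powers cut out fat points. -/
def pointIdeal (p : P2) : Ideal (MvPolynomial (Fin 3) ℂ) := RingHom.ker (eval p.rep)

/-- The degree-`d` graded component of a homogeneous ideal `I`. -/
def idealCompI (I : Ideal (MvPolynomial (Fin 3) ℂ)) (d : ℕ) :
    Submodule ℂ (MvPolynomial (Fin 3) ℂ) :=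
  homogeneousSubmodule (Fin 3) ℂ d ⊓ Submodule.restrictScalars ℂ I

/-- The Hilbert function of `S/I`. -/
def HFI (I : Ideal (MvPolynomial (Fin 3) ℂ)) (d : ℕ) : ℤ :=
  (Module.finrank ℂ ↥(homogeneousSubmodule (Fin 3) ℂ d) : ℤ) -
    (Module.finrank ℂ ↥(idealCompI I d) : ℤ)

/-- The h-vector of `S/I`. -/
def hvecI (I : Ideal (MvPolynomial (Fin 3) ℂ)) : ℕ → ℤ
  | 0 => HFI I 0
  | d + 1 => HFI I (d + 1) - HFI I d

/-- The Hadamard-product relation: `R = P ⋆ Q`. -/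
def hadRel (P Q R : P2) : Prop :=
  ∃ (u v : Fin 3 → ℂ) (hu : u ≠ 0) (hv : v ≠ 0) (huv : (fun i => u i * v i) ≠ 0),
    Projectivization.mk ℂ u hu = P ∧ Projectivization.mk ℂ v hv = Q ∧
      Projectivization.mk ℂ (fun i => u i * v i) huv = R

/-- `Δ₀`: points of `ℙ²` with at most one nonzero coordinate. -/
def Δ₀ : Set P2 := {p : P2 | ∃ i : Fin 3, ∀ j : Fin 3, j ≠ i → p.rep j = 0}

theorem eval_smul_of_isHomogeneous {F : MvPolynomial (Fin 3) ℂ} {n : ℕ} (hF : F.IsHomogeneous n)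
    (c : ℂ) (v : Fin 3 → ℂ) : eval (c • v) F = c ^ n * eval v F := by
  rw [eval_eq, eval_eq, Finset.mul_sum]
  refine Finset.sum_congr rfl fun e he => ?_
  have h := hF.degree_eq_sum_deg_support he
  simp only [Pi.smul_apply, smul_eq_mul, mul_pow, Finset.prod_mul_distrib,
    Finset.prod_pow_eq_pow_sum, ← h]
  ring

theorem exists_quadraticForm_of_isHomogeneous {q : MvPolynomial (Fin 3) ℂ}
    (hq : q.IsHomogeneous 2) : ∃ Q : QuadraticForm ℂ (Fin 3 → ℂ), ∀ w, eval w q = Q w := by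
  have h1 : ∀ f ∈ homogeneousSubmodule (Fin 3) ℂ 1,
      ∃ φ : (Fin 3 → ℂ) →ₗ[ℂ] ℂ, ∀ w, eval w f = φ w := by
    intro f hf
    rw [homogeneousSubmodule_one_eq_span_X] at hf
    induction hf using Submodule.span_induction with
    | mem x hx =>
      obtain ⟨i, rfl⟩ := hx
      exact ⟨LinearMap.proj i, by simp⟩
    | zero => exact ⟨0, by simp⟩
    | add x y _ _ hx hy =>
      obtain ⟨φ, hφ⟩ := hx
      obtain ⟨ψ, hψ⟩ := hy
      exact ⟨φ + ψ, by simp [hφ, hψ]⟩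
    | smul c x _ hx =>
      obtain ⟨φ, hφ⟩ := hx
      exact ⟨c • φ, by simp [hφ]⟩
  have hq' : q ∈ homogeneousSubmodule (Fin 3) ℂ 1 * homogeneousSubmodule (Fin 3) ℂ 1 := by
    rw [← pow_two, homogeneousSubmodule_one_pow]
    exact hq
  induction hq' using Submodule.mul_induction_on' with
  | mem_mul_mem f hf g hg =>
    obtain ⟨φ, hφ⟩ := h1 f hf
    obtain ⟨ψ, hψ⟩ := h1 g hg
    exact ⟨QuadraticMap.linMulLin φ ψ, by simp [hφ, hψ]⟩
  | add x _ y _ hx hy =>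
    have hx' : x ∈ homogeneousSubmodule (Fin 3) ℂ 2 := by
      rwa [← homogeneousSubmodule_one_pow, pow_two]
    have hy' : y ∈ homogeneousSubmodule (Fin 3) ℂ 2 := by
      rwa [← homogeneousSubmodule_one_pow, pow_two]
    obtain ⟨φ, hφ⟩ := hx hx'
    obtain ⟨ψ, hψ⟩ := hy hy'
    exact ⟨φ + ψ, by simp [hφ, hψ]⟩

/-- The linear form, as a polynomial, attached to a linear functional. -/
def linForm (φ : (Fin 3 → ℂ) →ₗ[ℂ] ℂ) : MvPolynomial (Fin 3) ℂ :=
  ∑ i, C (φ (Pi.single i 1)) * X i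

theorem linForm_isHomogeneous (φ : (Fin 3 → ℂ) →ₗ[ℂ] ℂ) : (linForm φ).IsHomogeneous 1 :=
  IsHomogeneous.sum _ _ _ fun i _ => isHomogeneous_C_mul_X _ i

@[simp]
theorem eval_linForm (φ : (Fin 3 → ℂ) →ₗ[ℂ] ℂ) (w : Fin 3 → ℂ) : eval w (linForm φ) = φ w := by
  conv_rhs => rw [← LinearMap.sum_single_apply (fun _ => ℂ) w, map_sum]
  simp only [linForm, map_sum, map_mul, eval_C, eval_X]
  refine Finset.sum_congr rfl fun i _ => ?_
  rw [mul_comm, ← smul_eq_mul, ← map_smul, ← Pi.single_smul]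
  simp

theorem not_irreducible_of_eval_eq_mul {q : MvPolynomial (Fin 3) ℂ}
    (φ ψ : (Fin 3 → ℂ) →ₗ[ℂ] ℂ) (h : ∀ w, eval w q = φ w * ψ w) : ¬ Irreducible q := by
  intro hq
  have e : q = linForm φ * linForm ψ := funext fun w => by simp [h]
  have hu : ∀ φ : (Fin 3 → ℂ) →ₗ[ℂ] ℂ, ¬ IsUnit (linForm φ) := fun φ hφ => by
    have h0 := hφ.map (eval (0 : Fin 3 → ℂ))
    rw [eval_linForm, map_zero] at h0
    exact not_isUnit_zero h0
  exact (hq.isUnit_or_isUnit e).elim (hu φ) (hu ψ)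

theorem exists_conic_coordinates {q : MvPolynomial (Fin 3) ℂ} (hq : q.IsHomogeneous 2)
    (hirr : Irreducible q) : ∃ T : (Fin 3 → ℂ) ≃ₗ[ℂ] (Fin 3 → ℂ),
      ∀ w, eval w q = T w 1 ^ 2 - 4 * T w 0 * T w 2 := by
  obtain ⟨Q, hQ⟩ := exists_quadraticForm_of_isHomogeneous hq
  obtain ⟨c, y, hy⟩ : ∃ (c : Fin 3 → ℂ) (y : (Fin 3 → ℂ) ≃ₗ[ℂ] (Fin 3 → ℂ)),
      ∀ w, eval w q = c 0 * y w 0 ^ 2 + c 1 * y w 1 ^ 2 + c 2 * y w 2 ^ 2 := by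
    obtain ⟨c, hc⟩ := QuadraticForm.equivalent_weightedSumSquares Q
    have h3 : Module.finrank ℂ (Fin 3 → ℂ) = 3 := by simp
    generalize Module.finrank ℂ (Fin 3 → ℂ) = n at h3 c hc
    subst h3
    obtain ⟨e⟩ := hc
    refine ⟨c, e.toLinearEquiv, fun w => ?_⟩
    rw [hQ, ← e.map_app w, QuadraticMap.weightedSumSquares_apply, Fin.sum_univ_three]
    simp only [smul_eq_mul, pow_two]
    rfl
  have hroot : ∀ z : ℂ, ∃ x, x ^ 2 = z := fun z => IsAlgClosed.exists_pow_nat_eq z two_pos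
  choose ρ hρ using hroot
  let Y : Fin 3 → (Fin 3 → ℂ) →ₗ[ℂ] ℂ := fun i => ρ (c i) • (LinearMap.proj i ∘ₗ y.toLinearMap)
  have hY : ∀ w, eval w q = Y 0 w ^ 2 + Y 1 w ^ 2 + Y 2 w ^ 2 := by
    intro w
    simp [Y, hy, mul_pow, hρ]
  have hne : ∀ i, ρ (c i) ≠ 0 := by
    intro i hi
    have hYi : ∀ w, Y i w = 0 := by simp [Y, hi]
    have I2 := Complex.I_sq
    refine not_irreducible_of_eval_eq_mul
      (Y (i + 1) + Complex.I • Y (i + 2)) (Y (i + 1) - Complex.I • Y (i + 2)) ?_ hirr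
    intro w
    have := hYi w
    rw [hY]
    fin_cases i <;> simp at this <;> simp [this]
    · linear_combination (Y 2 w) ^ 2 * I2
    · linear_combination (Y 0 w) ^ 2 * I2
    · linear_combination (Y 1 w) ^ 2 * I2
  let S : (Fin 3 → ℂ) →ₗ[ℂ] (Fin 3 → ℂ) :=
    LinearMap.pi ![(1 / 2 : ℂ) • (Y 0 + Complex.I • Y 1), Y 2,
      (-1 / 2 : ℂ) • (Y 0 - Complex.I • Y 1)]
  have hS : Function.Injective S := by
    rw [injective_iff_map_eq_zero]
    intro w hw
    have h0 := congrFun hw 0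
    have h1 := congrFun hw 1
    have h2 := congrFun hw 2
    simp [S] at h0 h1 h2
    have hI := Complex.I_ne_zero
    have hy0 : Y 0 w = 0 := by linear_combination h0 + h2 / 2
    have hy1 : Y 1 w = 0 := by
      have : Complex.I * Y 1 w = 0 := by linear_combination h0 - h2 / 2
      simpa using this
    have hz : ∀ i, Y i w = 0 → y w i = 0 := fun i h => by simpa [Y, hne] using h
    rw [← y.map_eq_zero_iff]
    ext i
    fin_cases i
    exacts [hz 0 hy0, hz 1 hy1, hz 2 h1]
  refine ⟨LinearEquiv.ofInjectiveEndo S hS, fun w => ?_⟩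
  rw [hY]
  simp [S]
  linear_combination (Y 1 w) ^ 2 * Complex.I_sq

/-- The tangent line, with parameter `t` in the dual conic, to the conic `y² = 4 x z` in the
coordinates `T`. -/
def tangentLine (T : (Fin 3 → ℂ) ≃ₗ[ℂ] (Fin 3 → ℂ)) (t : ℂ × ℂ) : Set P2 :=
  {p | t.1 ^ 2 * T p.rep 0 - t.1 * t.2 * T p.rep 1 + t.2 ^ 2 * T p.rep 2 = 0}

/-- The bracket of two vectors of `ℂ²`. -/
def bracket (t t' : ℂ × ℂ) : ℂ := t.1 * t'.2 - t'.1 * t.2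

/-- The meeting point of the tangent lines with parameters `t` and `t'`. -/
def meet (t t' : ℂ × ℂ) : Fin 3 → ℂ := ![t.2 * t'.2, t.1 * t'.2 + t'.1 * t.2, t.1 * t'.1]

theorem meet_ne_zero {t t' : ℂ × ℂ} (h : bracket t t' ≠ 0) : meet t t' ≠ 0 := by
  intro h0
  have e0 : t.2 * t'.2 = 0 := congrFun h0 0
  have e1 : t.1 * t'.2 + t'.1 * t.2 = 0 := congrFun h0 1
  apply h
  have : bracket t t' ^ 2 = 0 := by
    unfold bracket
    linear_combination (t.1 * t'.2 + t'.1 * t.2) * e1 - 4 * t.1 * t'.1 * e0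
  simpa using this

theorem meet_self_ne_zero {t : ℂ × ℂ} (h : t ≠ 0) : meet t t ≠ 0 := by
  intro h0
  have e0 : t.2 * t.2 = 0 := congrFun h0 0
  have e2 : t.1 * t.1 = 0 := congrFun h0 2
  exact h (Prod.ext (by simpa using e2) (by simpa using e0))

theorem tangentLine_eq_of_bracket_eq_zero (T : (Fin 3 → ℂ) ≃ₗ[ℂ] (Fin 3 → ℂ)) {t t' : ℂ × ℂ}
    (ht : t ≠ 0) (ht' : t' ≠ 0) (h : bracket t t' = 0) : tangentLine T t = tangentLine T t' := by
  obtain ⟨c, hc, e1, e2⟩ : ∃ c : ℂ, c ≠ 0 ∧ t'.1 = c * t.1 ∧ t'.2 = c * t.2 := by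
    unfold bracket at h
    obtain ⟨u, v⟩ := t
    obtain ⟨u', v'⟩ := t'
    simp only at h ⊢
    by_cases hu : u = 0
    · subst hu
      have hv : v ≠ 0 := by rintro rfl; exact ht rfl
      have hu' : u' = 0 := by simpa [hv] using h
      subst hu'
      refine ⟨v' / v, div_ne_zero ?_ hv, by simp, by field_simp⟩
      rintro rfl
      exact ht' rfl
    · refine ⟨u' / u, div_ne_zero ?_ hu, by field_simp, by field_simp; linear_combination h⟩
      rintro rfl
      have : v' = 0 := by simpa [hu] using h
      exact ht' (by rw [this]; rfl)
  ext p
  simp only [tangentLine, Set.mem_ofPred_eq, e1, e2]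
  have : (c * t.1) ^ 2 * T p.rep 0 - c * t.1 * (c * t.2) * T p.rep 1 + (c * t.2) ^ 2 * T p.rep 2
      = c ^ 2 * (t.1 ^ 2 * T p.rep 0 - t.1 * t.2 * T p.rep 1 + t.2 ^ 2 * T p.rep 2) := by ring
  rw [this, mul_eq_zero, or_iff_right (pow_ne_zero _ hc)]

theorem exists_rep_mk_eq_smul (v : Fin 3 → ℂ) (hv : v ≠ 0) :
    ∃ c : ℂ, c ≠ 0 ∧ (Projectivization.mk ℂ v hv).rep = c • v := by
  obtain ⟨a, ha⟩ := Projectivization.exists_smul_eq_mk_rep ℂ v hv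
  exact ⟨a, a.ne_zero, ha.symm⟩

theorem exists_rep_eq_smul_meet (T : (Fin 3 → ℂ) ≃ₗ[ℂ] (Fin 3 → ℂ)) {t t' : ℂ × ℂ}
    (h : bracket t t' ≠ 0) {p : P2} (hp : p ∈ tangentLine T t) (hp' : p ∈ tangentLine T t') :
    ∃ c : ℂ, p.rep = c • T.symm (meet t t') := by
  have h0 := meet_ne_zero h
  simp only [tangentLine, Set.mem_ofPred_eq] at hp hp'
  generalize p.rep = w at hp hp' ⊢
  have e01 : T w 0 * meet t t' 1 = T w 1 * meet t t' 0 := by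
    apply mul_left_cancel₀ h
    simp [meet, bracket, -mul_eq_mul_left_iff]
    linear_combination t'.2 ^ 2 * hp - t.2 ^ 2 * hp'
  have e02 : T w 0 * meet t t' 2 = T w 2 * meet t t' 0 := by
    apply mul_left_cancel₀ h
    simp [meet, bracket, -mul_eq_mul_left_iff]
    linear_combination t'.1 * t'.2 * hp - t.1 * t.2 * hp'
  have e12 : T w 1 * meet t t' 2 = T w 2 * meet t t' 1 := by
    apply mul_left_cancel₀ h
    simp [meet, bracket, -mul_eq_mul_left_iff]
    linear_combination t'.1 ^ 2 * hp - t.1 ^ 2 * hp'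
  obtain ⟨j, hj⟩ := Function.ne_iff.mp h0
  refine ⟨T w j / meet t t' j, ?_⟩
  apply T.injective
  rw [map_smul, T.apply_symm_apply]
  ext i
  simp only [Pi.smul_apply, smul_eq_mul]
  simp only [Pi.zero_apply] at hj
  field_simp
  fin_cases i <;> fin_cases j <;> simp_all

theorem mk_meet_mem_tangentLine (T : (Fin 3 → ℂ) ≃ₗ[ℂ] (Fin 3 → ℂ)) {t t' : ℂ × ℂ}
    (h : T.symm (meet t t') ≠ 0) :
    Projectivization.mk ℂ _ h ∈ tangentLine T t ∧ Projectivization.mk ℂ _ h ∈ tangentLine T t' := by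
  obtain ⟨c, -, hc⟩ := exists_rep_mk_eq_smul _ h
  simp only [tangentLine, Set.mem_ofPred_eq, hc, map_smul, T.apply_symm_apply, Pi.smul_apply,
    smul_eq_mul]
  constructor <;> simp [meet] <;> ring

theorem exists_eq_tangentLine {q : MvPolynomial (Fin 3) ℂ} (T : (Fin 3 → ℂ) ≃ₗ[ℂ] (Fin 3 → ℂ))
    (hT : ∀ w, eval w q = T w 1 ^ 2 - 4 * T w 0 * T w 2) {L : Set P2} (hL : IsLine L)
    (ht : IsTangent L {p : P2 | eval p.rep q = 0}) : ∃ t : ℂ × ℂ, t ≠ 0 ∧ L = tangentLine T t := by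
  obtain ⟨a, ha, rfl⟩ := hL
  obtain ⟨p, hp⟩ := ht
  let φ : (Fin 3 → ℂ) →ₗ[ℂ] ℂ := ∑ i, a i • LinearMap.proj i
  let α : Fin 3 → ℂ := fun i => φ (T.symm (Pi.single i 1))
  have hα : ∀ w, ∑ i, a i * w i = α 0 * T w 0 + α 1 * T w 1 + α 2 * T w 2 := by
    intro w
    have e1 : ∑ i, a i * w i = φ w := by simp [φ]
    have e2 : w = T.symm (∑ i, T w i • Pi.single i (1 : ℂ)) := by
      rw [T.eq_symm_apply]
      ext j
      simp [Pi.single_apply]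
    rw [e1]
    conv_lhs => rw [e2]
    simp only [Fin.sum_univ_three, map_add, map_smul, smul_eq_mul, α]
    ring
  have hα0 : α ≠ 0 := by
    intro h0
    apply ha
    ext i
    have := hα (Pi.single i 1)
    simpa [h0, Pi.single_apply] using this
  have hroot : ∀ t : ℂ × ℂ, t ≠ 0 → α 0 * t.2 ^ 2 + 2 * α 1 * (t.1 * t.2) + α 2 * t.1 ^ 2 = 0 →
      ∃ c : ℂ, c ≠ 0 ∧ p.rep = c • T.symm (meet t t) := by
    intro t ht0 htr
    have hne : T.symm (meet t t) ≠ 0 := by simpa using meet_self_ne_zero ht0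
    obtain ⟨c, hc0, hc⟩ := exists_rep_mk_eq_smul _ hne
    have hmem : Projectivization.mk ℂ _ hne ∈
        {p : P2 | (∑ i, a i * p.rep i) = 0} ∩ {p : P2 | eval p.rep q = 0} := by
      refine ⟨?_, ?_⟩
      · simp only [Set.mem_ofPred_eq]
        rw [hα, hc]
        simp [meet]
        linear_combination c * htr
      · simp only [Set.mem_ofPred_eq]
        rw [hT, hc]
        simp [meet]
        ring
    rw [hp, Set.mem_singleton_iff] at hmem
    exact ⟨c, hc0, by rw [← hmem, hc]⟩
  have hdisc : α 1 ^ 2 = α 0 * α 2 := by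
    by_contra hne
    obtain ⟨δ, hδ⟩ := IsAlgClosed.exists_pow_nat_eq (α 1 ^ 2 - α 0 * α 2) two_pos
    have hδ0 : δ ≠ 0 := by
      rintro rfl
      apply hne
      linear_combination -hδ
    obtain ⟨t, t', hb, h1, h2⟩ : ∃ t t' : ℂ × ℂ, bracket t t' ≠ 0 ∧
        α 0 * t.2 ^ 2 + 2 * α 1 * (t.1 * t.2) + α 2 * t.1 ^ 2 = 0 ∧
        α 0 * t'.2 ^ 2 + 2 * α 1 * (t'.1 * t'.2) + α 2 * t'.1 ^ 2 = 0 := by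
      by_cases h0 : α 0 = 0
      · refine ⟨(0, 1), (2 * α 1, -α 2), ?_, by simp [h0], by simp [h0]; ring⟩
        simp [bracket]
        intro h1
        apply hne
        simp [h0, h1]
      · refine ⟨(α 0, -α 1 + δ), (α 0, -α 1 - δ), ?_, ?_, ?_⟩
        · have : bracket (α 0, -α 1 + δ) (α 0, -α 1 - δ) = - 2 * α 0 * δ := by
            simp [bracket]; ring
          rw [this]
          simp [h0, hδ0]
        · linear_combination α 0 * hδ
        · linear_combination α 0 * hδ
    have hz : t ≠ 0 := by rintro rfl; simp [bracket] at hb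
    have hz' : t' ≠ 0 := by rintro rfl; simp [bracket] at hb
    obtain ⟨c, hc0, hc⟩ := hroot t hz h1
    obtain ⟨c', hc0', hc'⟩ := hroot t' hz' h2
    have e : c • meet t t = c' • meet t' t' := by
      apply T.symm.injective
      rw [map_smul, map_smul, ← hc, hc']
    have e0 : c * (t.2 * t.2) = c' * (t'.2 * t'.2) := congrFun e 0
    have e1 : c * (t.1 * t.2 + t.1 * t.2) = c' * (t'.1 * t'.2 + t'.1 * t'.2) := congrFun e 1
    have e2 : c * (t.1 * t.1) = c' * (t'.1 * t'.1) := congrFun e 2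
    have : c * bracket t t' ^ 2 = 0 := by
      unfold bracket
      linear_combination t'.1 ^ 2 * e0 - t'.1 * t'.2 * e1 + t'.2 ^ 2 * e2
    simp [hc0, hb] at this
  obtain ⟨u, hu⟩ := IsAlgClosed.exists_pow_nat_eq (α 0) two_pos
  obtain ⟨v, hv, huv⟩ : ∃ v, v ^ 2 = α 2 ∧ u * v = -α 1 := by
    obtain ⟨v, hv⟩ := IsAlgClosed.exists_pow_nat_eq (α 2) two_pos
    have : (u * v + α 1) * (u * v - α 1) = 0 := by
      linear_combination v ^ 2 * hu + α 0 * hv - hdisc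
    rcases mul_eq_zero.mp this with h | h
    · exact ⟨v, hv, by linear_combination h⟩
    · exact ⟨-v, by linear_combination hv, by linear_combination -h⟩
  refine ⟨(u, v), ?_, ?_⟩
  · intro h
    simp only [Prod.mk_eq_zero] at h
    apply hα0
    ext i
    fin_cases i
    · simp [← hu, h.1]
    · simpa [h.1] using huv
    · simp [← hv, h.2]
  · ext p
    simp only [tangentLine, Set.mem_ofPred_eq, hα, hu, hv, huv]
    rw [neg_mul, sub_neg_eq_add]

/-- The point with parameter `t` on the rational normal curve in `ℂᴺ`. -/
def veronese (N : ℕ) (t : ℂ × ℂ) : Fin N → ℂ := fun k => t.1 ^ (k : ℕ) * t.2 ^ (k.rev : ℕ)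

theorem linearIndependent_veronese {ι : Type*} [Fintype ι] (t : ι → ℂ × ℂ)
    (ht0 : ∀ i, t i ≠ 0) (ht : Pairwise fun i j => bracket (t i) (t j) ≠ 0) (N : ℕ)
    (hN : Fintype.card ι ≤ N) :
    LinearIndependent ℂ fun i => veronese N (t i) := by
  induction N, hN using Nat.le_induction with
  | base =>
    let e := Fintype.equivFin ι
    have hdet : (Matrix.projVandermonde (fun i => (t (e.symm i)).1)
        (fun i => (t (e.symm i)).2)).det ≠ 0 := by
      rw [Matrix.det_projVandermonde]
      refine Finset.prod_ne_zero_iff.mpr fun i _ => Finset.prod_ne_zero_iff.mpr fun j hj => ?_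
      exact ht (e.symm.injective.ne (Finset.mem_Ioi.mp hj).ne')
    have h := Matrix.linearIndependent_rows_of_det_ne_zero hdet
    have h2 := h.comp e e.injective
    have he : (fun i => veronese (Fintype.card ι) (t i)) =
        (Matrix.projVandermonde (fun i => (t (e.symm i)).1) fun i => (t (e.symm i)).2) ∘ e := by
      ext i k
      change _ = Matrix.projVandermonde (fun i => (t (e.symm i)).1)
        (fun i => (t (e.symm i)).2) (e i) k
      simp [Matrix.projVandermonde_apply, veronese]
    rw [he]
    exact h2
  | succ N hN ih =>
    rw [Fintype.linearIndependent_iff] at ih ⊢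
    intro c hc
    have h1 := ih (fun i => c i * (t i).1) (by
      ext k
      have := congrFun hc k.succ
      simp only [Finset.sum_apply, Pi.smul_apply, veronese, smul_eq_mul, Fin.val_succ,
        Fin.rev_succ, Fin.val_castSucc, Pi.zero_apply] at this ⊢
      rw [← this]
      exact Finset.sum_congr rfl fun i _ => by ring)
    have h2 := ih (fun i => c i * (t i).2) (by
      ext k
      have := congrFun hc k.castSucc
      simp only [Finset.sum_apply, Pi.smul_apply, veronese, smul_eq_mul, Fin.val_succ,
        Fin.rev_castSucc, Fin.val_castSucc, Pi.zero_apply] at this ⊢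
      rw [← this]
      exact Finset.sum_congr rfl fun i _ => by ring)
    intro i
    by_contra hi
    have e1 : (t i).1 = 0 := by simpa [hi] using h1 i
    have e2 : (t i).2 = 0 := by simpa [hi] using h2 i
    exact ht0 i (Prod.ext e1 e2)

theorem span_veronese_eq_top {ι : Type*} [Fintype ι] (t : ι → ℂ × ℂ)
    (ht0 : ∀ i, t i ≠ 0) (ht : Pairwise fun i j => bracket (t i) (t j) ≠ 0) (N : ℕ)
    (hN : N ≤ Fintype.card ι) :
    Submodule.span ℂ (Set.range fun i => veronese N (t i)) = ⊤ := by
  obtain ⟨f⟩ : Nonempty (Fin N ↪ ι) := Function.Embedding.nonempty_of_card_le (by simpa using hN)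
  have h := linearIndependent_veronese (t ∘ f) (fun i => ht0 (f i))
    (fun i j hij => ht (f.injective.ne hij)) N (by simp)
  refine top_le_iff.mp ((h.span_eq_top_of_card_eq_finrank' (by simp)).ge.trans
    (Submodule.span_mono ?_))
  rintro _ ⟨i, rfl⟩
  exact ⟨f i, rfl⟩

/-- The homogeneous Chebyshev-type polynomials `∑ aⁱ b^(k-i)`, in terms of `y = a + b` and
`x z = a b`. -/
def chebyshevForm (x y z : MvPolynomial (Fin 3) ℂ) : ℕ → MvPolynomial (Fin 3) ℂ
  | 0 => 1
  | 1 => y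
  | k + 2 => y * chebyshevForm x y z (k + 1) - x * z * chebyshevForm x y z k

theorem chebyshevForm_isHomogeneous {x y z : MvPolynomial (Fin 3) ℂ} (hx : x.IsHomogeneous 1)
    (hy : y.IsHomogeneous 1) (hz : z.IsHomogeneous 1) (k : ℕ) :
    (chebyshevForm x y z k).IsHomogeneous k := by
  induction k using Nat.twoStepInduction with
  | zero => exact isHomogeneous_one _ _
  | one => exact hy
  | more k h0 h1 =>
    refine IsHomogeneous.sub ?_ ?_
    · have h := hy.mul h1
      rwa [show 1 + (k + 1) = k + 2 by omega] at h
    · have h := (hx.mul hz).mul h0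
      rwa [show 1 + 1 + k = k + 2 by omega] at h

theorem mul_eval_chebyshevForm {x y z : MvPolynomial (Fin 3) ℂ} {w : Fin 3 → ℂ} {a b : ℂ}
    (hy : eval w y = a + b) (hxz : eval w x * eval w z = a * b) (k : ℕ) :
    (a - b) * eval w (chebyshevForm x y z k) = a ^ (k + 1) - b ^ (k + 1) := by
  induction k using Nat.twoStepInduction with
  | zero => simp [chebyshevForm]
  | one =>
    simp [chebyshevForm, hy]
    ring
  | more k h0 h1 =>
    simp only [chebyshevForm, map_sub, map_mul, hy, hxz]
    linear_combination (a + b) * h1 - a * b * h0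

theorem exists_form_eval_meet_of_lt (T : (Fin 3 → ℂ) ≃ₗ[ℂ] (Fin 3 → ℂ)) {d : ℕ}
    {k l : Fin (d + 2)} (hkl : l < k) : ∃ F : MvPolynomial (Fin 3) ℂ, F.IsHomogeneous d ∧
      ∀ t t' : ℂ × ℂ, bracket t t' * eval (T.symm (meet t t')) F =
        veronese (d + 2) t k * veronese (d + 2) t' l -
          veronese (d + 2) t' k * veronese (d + 2) t l := by
  let L : Fin 3 → MvPolynomial (Fin 3) ℂ := fun i => linForm (LinearMap.proj i ∘ₗ T.toLinearMap)
  have hL : ∀ i, (L i).IsHomogeneous 1 := fun i => linForm_isHomogeneous _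
  have hLe : ∀ i w, eval (T.symm w) (L i) = w i := fun i w => by simp [L]
  obtain ⟨n, hn⟩ : ∃ n, (k : ℕ) = l + n + 1 := ⟨k - l - 1, by omega⟩
  obtain ⟨m, hm⟩ : ∃ m, d + 1 = k + m := ⟨d + 1 - k, by omega⟩
  refine ⟨L 2 ^ (l : ℕ) * L 0 ^ m * chebyshevForm (L 0) (L 1) (L 2) n, ?_, fun t t' => ?_⟩
  · convert (((hL 2).pow l).mul ((hL 0).pow m)).mul
      (chebyshevForm_isHomogeneous (hL 0) (hL 1) (hL 2) n) using 1
    omega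
  · have h := mul_eval_chebyshevForm (x := L 0) (y := L 1) (z := L 2)
      (w := T.symm (meet t t')) (a := t.1 * t'.2) (b := t'.1 * t.2)
      (by rw [hLe]; rfl) (by rw [hLe, hLe]; simp [meet]; ring) n
    have e1 : (k.rev : ℕ) = m := by rw [Fin.val_rev]; omega
    have e2 : (l.rev : ℕ) = n + 1 + m := by rw [Fin.val_rev]; omega
    simp only [map_mul, map_pow, hLe, veronese, e1, e2, hn]
    change bracket t t' * ((t.1 * t'.1) ^ (l : ℕ) * (t.2 * t'.2) ^ m * _) = _
    unfold bracket
    linear_combination (t.1 * t'.1) ^ (l : ℕ) * (t.2 * t'.2) ^ m * h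

theorem exists_form_eval_meet (T : (Fin 3 → ℂ) ≃ₗ[ℂ] (Fin 3 → ℂ)) {d : ℕ}
    (g h : (Fin (d + 2) → ℂ) →ₗ[ℂ] ℂ) : ∃ F : MvPolynomial (Fin 3) ℂ, F.IsHomogeneous d ∧
      ∀ t t' : ℂ × ℂ, bracket t t' * eval (T.symm (meet t t')) F =
        g (veronese (d + 2) t) * h (veronese (d + 2) t') -
          g (veronese (d + 2) t') * h (veronese (d + 2) t) := by
  have key : ∀ k l : Fin (d + 2), ∃ F : MvPolynomial (Fin 3) ℂ, F.IsHomogeneous d ∧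
      ∀ t t' : ℂ × ℂ, bracket t t' * eval (T.symm (meet t t')) F =
        veronese (d + 2) t k * veronese (d + 2) t' l -
          veronese (d + 2) t' k * veronese (d + 2) t l := by
    intro k l
    rcases lt_trichotomy l k with hkl | rfl | hkl
    · exact exists_form_eval_meet_of_lt T hkl
    · exact ⟨0, isHomogeneous_zero _ _ _, fun t t' => by simp; ring⟩
    · obtain ⟨F, hF, hF'⟩ := exists_form_eval_meet_of_lt T hkl
      refine ⟨-F, hF.neg, fun t t' => ?_⟩
      rw [map_neg]
      linear_combination -hF' t t'
  choose F hF hF' using key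
  refine ⟨∑ k, ∑ l, C (g (Pi.single k 1) * h (Pi.single l 1)) * F k l,
    IsHomogeneous.sum _ _ _ fun k _ => IsHomogeneous.sum _ _ _ fun l _ => (hF k l).C_mul _,
    fun t t' => ?_⟩
  have expand : ∀ (g : (Fin (d + 2) → ℂ) →ₗ[ℂ] ℂ) w, g w = ∑ k, g (Pi.single k 1) * w k := by
    intro g w
    rw [LinearMap.pi_apply_eq_sum_univ g w]
    refine Finset.sum_congr rfl fun k _ => ?_
    rw [smul_eq_mul, mul_comm]
    congr 2
    ext j
    simp [Pi.single_apply, eq_comm]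
  rw [expand g, expand h, expand g (veronese _ t'), expand h (veronese _ t),
    Finset.sum_mul_sum, Finset.sum_mul_sum, ← Finset.sum_sub_distrib, map_sum, Finset.mul_sum]
  refine Finset.sum_congr rfl fun k _ => ?_
  rw [← Finset.sum_sub_distrib, map_sum, Finset.mul_sum]
  refine Finset.sum_congr rfl fun l _ => ?_
  rw [map_mul, eval_C]
  linear_combination (g (Pi.single k 1) * h (Pi.single l 1)) * hF' k l t t'

theorem exists_nat_family_span_eq {V : Type*} [AddCommGroup V] [Module ℂ V] [FiniteDimensional ℂ V]
    (A : Submodule ℂ V) :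
    ∃ f : ℕ → V, Submodule.span ℂ (f '' {i | i < Module.finrank ℂ A}) = A := by
  let e := Module.finBasis ℂ A
  refine ⟨fun i => if h : i < Module.finrank ℂ A then e ⟨i, h⟩ else 0, ?_⟩
  have : (fun i => if h : i < Module.finrank ℂ A then (e ⟨i, h⟩ : V) else 0) ''
      {i | i < Module.finrank ℂ A} = A.subtype '' Set.range e := by
    ext x
    constructor
    · rintro ⟨i, hi, rfl⟩
      have hi' : i < Module.finrank ℂ A := hi
      exact ⟨_, ⟨⟨i, hi⟩, rfl⟩, by simp [hi']⟩
    · rintro ⟨_, ⟨i, rfl⟩, rfl⟩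
      exact ⟨i, i.2, by simp⟩
  rw [this, ← Submodule.map_span, e.span_eq, Submodule.map_top, Submodule.range_subtype]

theorem exists_basis_of_sup_eq_top {V : Type*} [AddCommGroup V] [Module ℂ V]
    [FiniteDimensional ℂ V] {N : ℕ} (hN : Module.finrank ℂ V = N) (A M D : Submodule ℂ V)
    (hsup : A ⊔ M ⊔ D = ⊤)
    (hdim : Module.finrank ℂ A + Module.finrank ℂ M + Module.finrank ℂ D = N) :
    ∃ b : Module.Basis (Fin N) ℂ V,
      Submodule.span ℂ (b '' {p | (p : ℕ) < Module.finrank ℂ A}) = A ∧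
      Submodule.span ℂ (b '' {p | (p : ℕ) < Module.finrank ℂ A + Module.finrank ℂ M}) = A ⊔ M ∧
      Submodule.span ℂ (b '' {p | Module.finrank ℂ A ≤ (p : ℕ)}) = M ⊔ D ∧
      Submodule.span ℂ (b '' {p | Module.finrank ℂ A + Module.finrank ℂ M ≤ (p : ℕ)}) = D := by
  obtain ⟨f, hf⟩ := exists_nat_family_span_eq A
  obtain ⟨g, hg⟩ := exists_nat_family_span_eq M
  obtain ⟨h, hh⟩ := exists_nat_family_span_eq D
  generalize Module.finrank ℂ A = a at *
  generalize Module.finrank ℂ M = m at *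
  generalize Module.finrank ℂ D = e at *
  let b : Fin N → V := fun p =>
    if (p : ℕ) < a then f p else if (p : ℕ) < a + m then g (p - a) else h (p - (a + m))
  have hA : b '' {p | (p : ℕ) < a} = f '' {i | i < a} := by
    ext x
    constructor
    · rintro ⟨p, hp, rfl⟩
      have hp' : (p : ℕ) < a := hp
      exact ⟨p, hp, by simp [b, hp']⟩
    · rintro ⟨i, hi, rfl⟩
      have hi' : i < a := hi
      exact ⟨⟨i, by omega⟩, hi, by simp [b, hi']⟩
  have hM : b '' {p | a ≤ (p : ℕ) ∧ (p : ℕ) < a + m} = g '' {i | i < m} := by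
    ext x
    constructor
    · rintro ⟨p, ⟨hp, hp'⟩, rfl⟩
      exact ⟨p - a, by change (p : ℕ) - a < m; omega, by simp [b, not_lt.mpr hp, hp']⟩
    · rintro ⟨i, hi, rfl⟩
      have hi' : i < m := hi
      exact ⟨⟨a + i, by omega⟩, ⟨by simp, by simpa using hi'⟩, by simp [b, hi']⟩
  have hD : b '' {p | a + m ≤ (p : ℕ)} = h '' {i | i < e} := by
    ext x
    constructor
    · rintro ⟨p, hp, rfl⟩
      have hp' : a + m ≤ (p : ℕ) := hp
      have hp2 : ¬ (p : ℕ) < a := by omega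
      exact ⟨p - (a + m), by change (p : ℕ) - (a + m) < e; omega, by
        simp [b, hp2, not_lt.mpr hp']⟩
    · rintro ⟨i, hi, rfl⟩
      have hi' : i < e := hi
      exact ⟨⟨a + m + i, by omega⟩, by simp, by
        simp only [b, add_assoc]
        rw [if_neg (by omega), if_neg (by omega)]
        congr 1
        omega⟩
  have hAM : Submodule.span ℂ (b '' {p | (p : ℕ) < a + m}) = A ⊔ M := by
    rw [← hf, ← hg, ← hA, ← hM, ← Submodule.span_union, ← Set.image_union]
    congr 2
    ext p
    simp only [Set.mem_ofPred_eq, Set.mem_union]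
    omega
  have hMD : Submodule.span ℂ (b '' {p | a ≤ (p : ℕ)}) = M ⊔ D := by
    rw [← hh, ← hg, ← hD, ← hM, ← Submodule.span_union, ← Set.image_union]
    congr 2
    ext p
    simp only [Set.mem_ofPred_eq, Set.mem_union]
    omega
  have htop : ⊤ ≤ Submodule.span ℂ (Set.range b) := by
    rw [← hsup, ← hAM, ← hh, ← hD, ← Submodule.span_union]
    refine Submodule.span_mono ?_
    rw [← Set.image_union]
    exact Set.image_subset_range _ _
  refine ⟨basisOfTopLeSpanOfCardEqFinrank b htop (by simp [hN]), ?_⟩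
  rw [coe_basisOfTopLeSpanOfCardEqFinrank, hA, hf, hD, hh]
  exact ⟨rfl, hAM, hMD, rfl⟩

theorem exists_basis_adapted {V : Type*} [AddCommGroup V] [Module ℂ V]
    [FiniteDimensional ℂ V] {N : ℕ} (hN : Module.finrank ℂ V = N) (E F : Submodule ℂ V)
    (h : E ⊓ F = ⊥ ∨ E ⊔ F = ⊤) :
    ∃ b : Module.Basis (Fin N) ℂ V,
      Submodule.span ℂ (b '' {p | (p : ℕ) < Module.finrank ℂ F}) = F ∧
      Submodule.span ℂ (b '' {p | N ≤ (p : ℕ) + Module.finrank ℂ E}) = E := by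
  have hEF := Submodule.finrank_sup_add_finrank_inf_eq E F
  rcases h with h | h
  · obtain ⟨C, hC⟩ := exists_isCompl (E ⊔ F)
    have h1 := Submodule.finrank_add_eq_of_isCompl hC
    rw [h, finrank_bot] at hEF
    obtain ⟨b, hF, -, -, hE⟩ := exists_basis_of_sup_eq_top hN F C E
      (by rw [← hC.sup_eq_top]; ac_rfl) (by omega)
    refine ⟨b, hF, ?_⟩
    convert hE using 4
    ext
    omega
  · obtain ⟨C, hC⟩ := exists_isCompl (E ⊓ F)
    have key : ∀ G : Submodule ℂ V, E ⊓ F ≤ G → (E ⊓ F) ⊔ (C ⊓ G) = G ∧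
        Module.finrank ℂ (E ⊓ F : Submodule ℂ V) + Module.finrank ℂ (C ⊓ G : Submodule ℂ V) =
          Module.finrank ℂ G := by
      intro G hG
      have h1 : (E ⊓ F) ⊔ (C ⊓ G) = G := by
        rw [← sup_inf_assoc_of_le C hG, hC.sup_eq_top, top_inf_eq]
      have h2 : (E ⊓ F) ⊓ (C ⊓ G) = ⊥ := by
        rw [← inf_assoc, hC.inf_eq_bot, bot_inf_eq]
      have h3 := Submodule.finrank_sup_add_finrank_inf_eq (E ⊓ F) (C ⊓ G)
      rw [h1, h2, finrank_bot] at h3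
      exact ⟨h1, by omega⟩
    obtain ⟨hE1, hE2⟩ := key E inf_le_left
    obtain ⟨hF1, hF2⟩ := key F inf_le_right
    rw [h, finrank_top] at hEF
    obtain ⟨b, -, hF, hE, -⟩ := exists_basis_of_sup_eq_top hN (C ⊓ F) (E ⊓ F) (C ⊓ E)
      (by rw [sup_comm (C ⊓ F), hF1, eq_top_iff, ← h]
          exact sup_le (hE1.ge.trans (sup_le_sup_right inf_le_right _)) le_sup_left) (by omega)
    refine ⟨b, ?_, ?_⟩
    · rw [sup_comm, hF1] at hF
      convert hF using 4
      ext
      omega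
    · rw [hE1] at hE
      convert hE using 4
      ext
      omega

theorem exists_basis_adapted_veronese {N r s : ℕ} (t : Fin r ⊕ Fin s → ℂ × ℂ)
    (ht0 : ∀ i, t i ≠ 0) (ht : Pairwise fun i j => bracket (t i) (t j) ≠ 0) :
    ∃ b : Module.Basis (Fin N) ℂ (Fin N → ℂ),
      Submodule.span ℂ (b '' {p | (p : ℕ) < s}) =
        Submodule.span ℂ (Set.range fun j => veronese N (t (Sum.inr j))) ∧
      Submodule.span ℂ (b '' {p | N ≤ (p : ℕ) + r}) =
        Submodule.span ℂ (Set.range fun i => veronese N (t (Sum.inl i))) := by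
  have hfin : ∀ {n : ℕ} (u : Fin n → Fin r ⊕ Fin s), Function.Injective u →
      Module.finrank ℂ (Submodule.span ℂ (Set.range fun i => veronese N (t (u i)))) = min n N := by
    intro n u hu
    have h0 := fun i => ht0 (u i)
    have h1 : Pairwise fun i j => bracket (t (u i)) (t (u j)) ≠ 0 := fun i j hij => ht (hu.ne hij)
    rcases le_total n N with h | h
    · rw [finrank_span_eq_card (linearIndependent_veronese (fun i => t (u i)) h0 h1 N
        (by simpa using h)), Fintype.card_fin, min_eq_left h]
    · have := span_veronese_eq_top (fun i => t (u i)) h0 h1 N (by simpa using h)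
      rw [this, finrank_top, min_eq_right h, Module.finrank_fin_fun]
  obtain ⟨b, hF, hE⟩ := exists_basis_adapted (N := N) (by simp)
    (Submodule.span ℂ (Set.range fun i => veronese N (t (Sum.inl i))))
    (Submodule.span ℂ (Set.range fun j => veronese N (t (Sum.inr j)))) (by
      rcases le_total (r + s) N with h | h
      · left
        have := linearIndependent_veronese t ht0 ht N (by simpa using h)
        exact disjoint_iff.mp (linearIndependent_sum.mp this).2.2
      · right
        rw [← Submodule.span_union, ← span_veronese_eq_top t ht0 ht N (by simpa using h)]
        congr 1
        ext x
        simp)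
  refine ⟨b, ?_, ?_⟩
  · rw [← hF, hfin _ Sum.inr_injective]
    congr 2
    ext p
    simp
  · rw [← hE, hfin _ Sum.inl_injective]
    congr 2
    ext p
    simp only [Set.mem_ofPred_eq]
    omega

theorem mem_vanishingSubmodule_starConfig_iff (T : (Fin 3 → ℂ) ≃ₗ[ℂ] (Fin 3 → ℂ)) {n d : ℕ}
    (u : Fin n → ℂ × ℂ) (hu : Pairwise fun i j => bracket (u i) (u j) ≠ 0)
    {F : MvPolynomial (Fin 3) ℂ} (hF : F.IsHomogeneous d) :
    F ∈ vanishingSubmodule (starConfig fun i => tangentLine T (u i)) ↔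
      ∀ i j, i ≠ j → eval (T.symm (meet (u i) (u j))) F = 0 := by
  constructor
  · intro h i j hij
    have h0 : T.symm (meet (u i) (u j)) ≠ 0 := by simpa using meet_ne_zero (hu hij)
    obtain ⟨c, hc, hc'⟩ := exists_rep_mk_eq_smul _ h0
    obtain ⟨h1, h2⟩ := mk_meet_mem_tangentLine T h0
    have h3 := h _ ⟨i, j, hij, h1, h2⟩
    rw [hc', eval_smul_of_isHomogeneous hF] at h3
    exact (mul_eq_zero.mp h3).resolve_left (pow_ne_zero _ hc)
  · rintro h p ⟨i, j, hij, hi, hj⟩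
    obtain ⟨c, hc⟩ := exists_rep_eq_smul_meet T (hu hij) hi hj
    rw [hc, eval_smul_of_isHomogeneous hF, h i j hij, mul_zero]

/-- The alternating bilinear form `g ∧ h`. -/
def wedge {V : Type*} [AddCommGroup V] [Module ℂ V] (g h : V →ₗ[ℂ] ℂ) : V →ₗ[ℂ] V →ₗ[ℂ] ℂ :=
  g.smulRight h - h.smulRight g

theorem wedge_apply {V : Type*} [AddCommGroup V] [Module ℂ V] (g h : V →ₗ[ℂ] ℂ) (x y : V) :
    wedge g h x y = g x * h y - g y * h x := by
  simp [wedge, mul_comm]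

theorem eq_zero_on_span {V : Type*} [AddCommGroup V] [Module ℂ V] (B : V →ₗ[ℂ] V →ₗ[ℂ] ℂ)
    {S S' : Set V} (h : ∀ x ∈ S, ∀ y ∈ S, B x y = 0)
    (hS : Submodule.span ℂ S' = Submodule.span ℂ S) : ∀ x ∈ S', ∀ y ∈ S', B x y = 0 := by
  have h1 : ∀ x ∈ S, Submodule.span ℂ S ≤ LinearMap.ker (B x) := fun x hx =>
    Submodule.span_le.mpr fun y hy => h x hx y hy
  intro x hx y hy
  have hx' : x ∈ Submodule.span ℂ S := hS ▸ Submodule.subset_span hx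
  have hy' : y ∈ Submodule.span ℂ S := hS ▸ Submodule.subset_span hy
  have h2 : Submodule.span ℂ S ≤ LinearMap.ker (B.flip y) :=
    Submodule.span_le.mpr fun x hx => h1 x hx hy'
  exact h2 hx'

/-- The pairs `p < q` of indices below `N`. -/
abbrev IncPair (N : ℕ) : Type := {k : Fin N × Fin N // k.1 < k.2}

/-- The alternating form whose coefficients in the basis dual to `b` are `c`. -/
def altForm {V : Type*} [AddCommGroup V] [Module ℂ V] {N : ℕ} (b : Module.Basis (Fin N) ℂ V)
    (c : IncPair N → ℂ) : V →ₗ[ℂ] V →ₗ[ℂ] ℂ :=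
  ∑ k, c k • wedge (b.coord k.1.1) (b.coord k.1.2)

theorem altForm_apply {V : Type*} [AddCommGroup V] [Module ℂ V] {N : ℕ}
    (b : Module.Basis (Fin N) ℂ V) (c : IncPair N → ℂ) (x y : V) :
    altForm b c x y = ∑ k, c k * (b.coord k.1.1 x * b.coord k.1.2 y -
      b.coord k.1.1 y * b.coord k.1.2 x) := by
  simp [altForm, wedge_apply]

theorem altForm_self {V : Type*} [AddCommGroup V] [Module ℂ V] {N : ℕ}
    (b : Module.Basis (Fin N) ℂ V) (c : IncPair N → ℂ) (x : V) : altForm b c x x = 0 := by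
  simp [altForm_apply]

theorem altForm_swap {V : Type*} [AddCommGroup V] [Module ℂ V] {N : ℕ}
    (b : Module.Basis (Fin N) ℂ V) (c : IncPair N → ℂ) (x y : V) :
    altForm b c x y = -altForm b c y x := by
  rw [altForm_apply, altForm_apply, ← Finset.sum_neg_distrib]
  exact Finset.sum_congr rfl fun _ _ => by ring

theorem altForm_basis {V : Type*} [AddCommGroup V] [Module ℂ V] {N : ℕ}
    (b : Module.Basis (Fin N) ℂ V) (c : IncPair N → ℂ) (k : IncPair N) :
    altForm b c (b k.1.1) (b k.1.2) = c k := by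
  rw [altForm_apply, Finset.sum_eq_single k]
  · have := k.2
    simp [this.ne']
  · rintro ⟨⟨p, q⟩, hpq⟩ - hne
    obtain ⟨⟨p', q'⟩, hpq'⟩ := k
    simp only [Module.Basis.coord_apply, Module.Basis.repr_self, Finsupp.single_apply]
    have h1 : ¬ (p' = p ∧ q' = q) := by rintro ⟨rfl, rfl⟩; exact hne rfl
    have h2 : ¬ (q' = p ∧ p' = q) := by rintro ⟨rfl, rfl⟩; exact lt_asymm hpq hpq'
    split_ifs <;> simp_all
  · simp

theorem altForm_eq_zero_on_image_iff {V : Type*} [AddCommGroup V] [Module ℂ V] {N : ℕ}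
    (b : Module.Basis (Fin N) ℂ V) (c : IncPair N → ℂ) (A : Set (Fin N)) :
    (∀ x ∈ b '' A, ∀ y ∈ b '' A, altForm b c x y = 0) ↔
      ∀ k : IncPair N, k.1.1 ∈ A → k.1.2 ∈ A → c k = 0 := by
  constructor
  · intro h k h1 h2
    rw [← altForm_basis b c k]
    exact h _ ⟨_, h1, rfl⟩ _ ⟨_, h2, rfl⟩
  · rintro h _ ⟨p, hp, rfl⟩ _ ⟨q, hq, rfl⟩
    rcases lt_trichotomy p q with hpq | rfl | hpq
    · exact (altForm_basis b c ⟨(p, q), hpq⟩).trans (h _ hp hq)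
    · exact altForm_self b c _
    · rw [altForm_swap, neg_eq_zero]
      exact (altForm_basis b c ⟨(q, p), hpq⟩).trans (h _ hq hp)

theorem forall_eval_meet_eq_zero_iff (T : (Fin 3 → ℂ) ≃ₗ[ℂ] (Fin 3 → ℂ)) {n d : ℕ}
    (b : Module.Basis (Fin (d + 2)) ℂ (Fin (d + 2) → ℂ))
    {ω : IncPair (d + 2) → MvPolynomial (Fin 3) ℂ}
    (hω : ∀ k t t', bracket t t' * eval (T.symm (meet t t')) (ω k) =
      b.coord k.1.1 (veronese (d + 2) t) * b.coord k.1.2 (veronese (d + 2) t') -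
        b.coord k.1.1 (veronese (d + 2) t') * b.coord k.1.2 (veronese (d + 2) t))
    (u : Fin n → ℂ × ℂ) (hu : Pairwise fun i j => bracket (u i) (u j) ≠ 0) (A : Set (Fin (d + 2)))
    (hA : Submodule.span ℂ (b '' A) =
      Submodule.span ℂ (Set.range fun i => veronese (d + 2) (u i)))
    (c : IncPair (d + 2) → ℂ) :
    (∀ i j, i ≠ j → eval (T.symm (meet (u i) (u j))) (∑ k, c k • ω k) = 0) ↔
      ∀ k : IncPair (d + 2), k.1.1 ∈ A → k.1.2 ∈ A → c k = 0 := by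
  have key : ∀ t t', bracket t t' * eval (T.symm (meet t t')) (∑ k, c k • ω k) =
      altForm b c (veronese (d + 2) t) (veronese (d + 2) t') := by
    intro t t'
    rw [altForm_apply, map_sum, Finset.mul_sum]
    refine Finset.sum_congr rfl fun k _ => ?_
    rw [smul_eval, ← hω]
    ring
  rw [← altForm_eq_zero_on_image_iff b]
  constructor
  · intro h
    refine eq_zero_on_span (altForm b c) ?_ hA
    rintro _ ⟨i, rfl⟩ _ ⟨j, rfl⟩
    rcases eq_or_ne i j with rfl | hij
    · exact altForm_self b c _
    · simp only [← key, h i j hij, mul_zero]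
  · intro h i j hij
    have h1 := eq_zero_on_span (altForm b c) h hA.symm _ ⟨i, rfl⟩ _ ⟨j, rfl⟩
    simp only [← key] at h1
    exact (mul_eq_zero.mp h1).resolve_left (hu hij)

theorem finrank_restrictSupport (A : Set (Fin 3 →₀ ℕ)) :
    Module.finrank ℂ (restrictSupport ℂ A) = Nat.card A :=
  Module.finrank_eq_nat_card_basis (basisRestrictSupport ℂ A)

theorem natCard_exponents_eq (d a b : ℕ) :
    Nat.card {e : Fin 3 →₀ ℕ | e.degree = d ∧ e 0 + a ≤ d ∧ e 1 + b ≤ d} =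
      Nat.card {k : IncPair (d + 2) // (k.1.1 : ℕ) + a ≤ d ∧ b + 1 ≤ (k.1.2 : ℕ)} := by
  have hdeg : ∀ e : Fin 3 →₀ ℕ, e.degree = e 0 + e 1 + e 2 := fun e => by
    rw [Finsupp.degree_eq_sum, Fin.sum_univ_three]
  refine Nat.card_congr
    { toFun := fun e => ⟨⟨(⟨e.1 0, by have := e.2.1; rw [hdeg] at this; omega⟩,
          ⟨d + 1 - e.1 1, by omega⟩), by
            have := e.2.1; rw [hdeg] at this; rw [Fin.mk_lt_mk]; omega⟩,
          by have := e.2.2; dsimp only; omega⟩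
      invFun := fun k => ⟨Finsupp.equivFunOnFinite.symm
          ![k.1.1.1, d + 1 - k.1.1.2, d - (k.1.1.1 + (d + 1 - k.1.1.2))], by
            have h1 := k.1.2
            have h2 := k.2
            rw [Fin.lt_def] at h1
            simp only [Set.mem_ofPred_eq, hdeg, Finsupp.equivFunOnFinite_symm_apply_apply,
              Matrix.cons_val]
            omega⟩
      left_inv := fun e => ?_
      right_inv := fun k => ?_ }
  · have h := e.2
    simp only [Set.mem_ofPred_eq, hdeg] at h
    ext i
    fin_cases i <;> simp <;> omega
  · ext
    · simp
    · have := k.1.1.2.2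
      simp
      omega

theorem finrank_homogeneousSubmodule (d : ℕ) :
    Module.finrank ℂ (homogeneousSubmodule (Fin 3) ℂ d) = Fintype.card (IncPair (d + 2)) := by
  have h : homogeneousSubmodule (Fin 3) ℂ d = restrictSupport ℂ
      {e : Fin 3 →₀ ℕ | e.degree = d ∧ e 0 + 0 ≤ d ∧ e 1 + 0 ≤ d} := by
    rw [homogeneousSubmodule_eq_finsupp_supported]
    change restrictSupport _ _ = _
    congr 1
    ext e
    refine ⟨fun h => ⟨h, ?_⟩, fun h => h.1⟩
    have h' : e.degree = d := h
    rw [Finsupp.degree_eq_sum, Fin.sum_univ_three] at h'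
    omega
  rw [h, finrank_restrictSupport, natCard_exponents_eq, ← Nat.card_eq_fintype_card]
  refine Nat.card_congr (Equiv.subtypeUnivEquiv fun k => ?_)
  have h1 := k.2
  rw [Fin.lt_def] at h1
  omega

theorem finrank_idealComp_union_starConfig (T : (Fin 3 → ℂ) ≃ₗ[ℂ] (Fin 3 → ℂ)) {r s : ℕ}
    (t : Fin r ⊕ Fin s → ℂ × ℂ) (ht0 : ∀ i, t i ≠ 0)
    (ht : Pairwise fun i j => bracket (t i) (t j) ≠ 0) (d : ℕ) :
    Module.finrank ℂ (idealComp (starConfig (fun i => tangentLine T (t (Sum.inl i))) ∪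
        starConfig fun j => tangentLine T (t (Sum.inr j))) d) =
      Nat.card {k : IncPair (d + 2) // (k.1.1 : ℕ) + r < d + 2 ∧ s ≤ (k.1.2 : ℕ)} := by
  obtain ⟨b, hbF, hbE⟩ := exists_basis_adapted_veronese (N := d + 2) t ht0 ht
  have hex := fun k : IncPair (d + 2) =>
    exists_form_eval_meet T (b.coord k.1.1) (b.coord k.1.2)
  choose ω hωh hω using hex
  have hli : LinearIndependent ℂ ω := by
    rw [Fintype.linearIndependent_iff]
    intro c hc k
    let u : Fin (d + 2) → ℂ × ℂ := fun i => ((i : ℕ), 1)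
    have hu : Pairwise fun i j => bracket (u i) (u j) ≠ 0 := fun i j hij => by
      simpa [bracket, u, sub_eq_zero, Fin.val_inj] using hij
    refine (forall_eval_meet_eq_zero_iff T b hω u hu Set.univ ?_ c).mp ?_ k trivial trivial
    · rw [Set.image_univ, b.span_eq, span_veronese_eq_top u (fun i => by simp [u]) hu _ (by simp)]
    · simp [hc]
  have hspan : Submodule.span ℂ (Set.range ω) = homogeneousSubmodule (Fin 3) ℂ d := by
    have : FiniteDimensional ℂ (homogeneousSubmodule (Fin 3) ℂ d) :=
      Module.finite_of_finrank_pos (by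
        rw [finrank_homogeneousSubmodule]
        exact Fintype.card_pos_iff.mpr ⟨⟨(0, 1), by simp⟩⟩)
    refine Submodule.eq_of_le_of_finrank_eq ?_ ?_
    · rw [Submodule.span_le]
      rintro _ ⟨k, rfl⟩
      exact hωh k
    · rw [finrank_span_eq_card hli, finrank_homogeneousSubmodule]
  have hsum : ∀ c : IncPair (d + 2) → ℂ, (∑ k, c k • ω k).IsHomogeneous d := fun c =>
    IsHomogeneous.sum _ _ _ fun k _ => by
      rw [smul_eq_C_mul]
      exact (hωh k).C_mul _
  have hmem : ∀ c : IncPair (d + 2) → ℂ,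
      ∑ k, c k • ω k ∈ idealComp (starConfig (fun i => tangentLine T (t (Sum.inl i))) ∪
        starConfig fun j => tangentLine T (t (Sum.inr j))) d ↔
      ∀ k : IncPair (d + 2), ¬ ((k.1.1 : ℕ) + r < d + 2 ∧ s ≤ (k.1.2 : ℕ)) → c k = 0 := by
    intro c
    have hE := forall_eval_meet_eq_zero_iff T b hω _
      (fun i j hij => ht (Sum.inl_injective.ne hij)) _ hbE c
    have hF := forall_eval_meet_eq_zero_iff T b hω _
      (fun i j hij => ht (Sum.inr_injective.ne hij)) _ hbF c
    rw [← mem_vanishingSubmodule_starConfig_iff T _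
      (fun i j hij => ht (Sum.inl_injective.ne hij)) (hsum c)] at hE
    rw [← mem_vanishingSubmodule_starConfig_iff T _
      (fun i j hij => ht (Sum.inr_injective.ne hij)) (hsum c)] at hF
    have hsplit : ∑ k, c k • ω k ∈ idealComp (starConfig
        (fun i => tangentLine T (t (Sum.inl i))) ∪
          starConfig fun j => tangentLine T (t (Sum.inr j))) d ↔
        ∑ k, c k • ω k ∈ vanishingSubmodule (starConfig
          (fun i => tangentLine T (t (Sum.inl i)))) ∧
        ∑ k, c k • ω k ∈ vanishingSubmodule (starConfig
          (fun j => tangentLine T (t (Sum.inr j)))) :=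
      ⟨fun h => ⟨fun p hp => h.2 p (Or.inl hp), fun p hp => h.2 p (Or.inr hp)⟩,
        fun h => ⟨hsum c, fun p hp => hp.elim (h.1 p) (h.2 p)⟩⟩
    rw [hsplit, hE, hF, ← forall_and]
    refine forall_congr' fun k => ?_
    have h1 := k.2
    rw [Fin.lt_def] at h1
    simp only [Set.mem_ofPred_eq]
    constructor
    · rintro ⟨h2, h3⟩ h4
      by_cases h5 : d + 2 ≤ (k.1.1 : ℕ) + r
      · exact h2 h5 (by omega)
      · exact h3 (by omega) (by omega)
    · exact fun h => ⟨fun h2 h3 => h (by omega), fun h2 h3 => h (by omega)⟩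
  have heq : idealComp (starConfig (fun i => tangentLine T (t (Sum.inl i))) ∪
        starConfig fun j => tangentLine T (t (Sum.inr j))) d =
      Submodule.span ℂ (Set.range fun k : {k : IncPair (d + 2) //
        (k.1.1 : ℕ) + r < d + 2 ∧ s ≤ (k.1.2 : ℕ)} => ω k) := by
    ext F
    constructor
    · intro hF
      have h1 : F ∈ Submodule.span ℂ (Set.range ω) := hspan ▸ hF.1
      obtain ⟨c, rfl⟩ := (Submodule.mem_span_range_iff_exists_fun ℂ).mp h1
      have h2 := (hmem c).mp hF
      refine Submodule.sum_mem _ fun k _ => ?_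
      by_cases hk : (k.1.1 : ℕ) + r < d + 2 ∧ s ≤ (k.1.2 : ℕ)
      · exact Submodule.smul_mem _ _ (Submodule.subset_span ⟨⟨k, hk⟩, rfl⟩)
      · rw [h2 k hk, zero_smul]
        exact Submodule.zero_mem _
    · revert F
      rw [← SetLike.le_def, Submodule.span_le]
      rintro _ ⟨k, rfl⟩
      have h := (hmem (Pi.single k.1 1)).mpr fun l hl => Pi.single_eq_of_ne
        (by rintro rfl; exact hl k.2) _
      simpa [Pi.single_apply] using h
  rw [heq, Nat.card_eq_fintype_card]
  exact finrank_span_eq_card (hli.comp _ Subtype.val_injective)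

/-- The algebra endomorphism `F ↦ F ∘ A`. -/
def substLinear (A : (Fin 3 → ℂ) ≃ₗ[ℂ] (Fin 3 → ℂ)) :
    MvPolynomial (Fin 3) ℂ →ₐ[ℂ] MvPolynomial (Fin 3) ℂ :=
  aeval fun j => linForm (LinearMap.proj j ∘ₗ A.toLinearMap)

theorem eval_substLinear (A : (Fin 3 → ℂ) ≃ₗ[ℂ] (Fin 3 → ℂ)) (w : Fin 3 → ℂ)
    (F : MvPolynomial (Fin 3) ℂ) : eval w (substLinear A F) = eval (A w) F := by
  have h : (eval w).comp (substLinear A).toRingHom = eval (A w) := by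
    ext j
    · simp
    · simp [substLinear]
  exact RingHom.congr_fun h F

theorem substLinear_isHomogeneous (A : (Fin 3 → ℂ) ≃ₗ[ℂ] (Fin 3 → ℂ)) {d : ℕ}
    {F : MvPolynomial (Fin 3) ℂ} (hF : F.IsHomogeneous d) : (substLinear A F).IsHomogeneous d := by
  have h := IsHomogeneous.aeval hF (fun j => linForm (LinearMap.proj j ∘ₗ A.toLinearMap))
    fun j => linForm_isHomogeneous _
  rwa [one_mul] at h

theorem substLinear_symm_substLinear (A : (Fin 3 → ℂ) ≃ₗ[ℂ] (Fin 3 → ℂ))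
    (F : MvPolynomial (Fin 3) ℂ) : substLinear A.symm (substLinear A F) = F :=
  MvPolynomial.funext fun w => by
    rw [eval_substLinear, eval_substLinear, A.apply_symm_apply]

theorem substLinear_mem_ker_pow (A : (Fin 3 → ℂ) ≃ₗ[ℂ] (Fin 3 → ℂ)) {v w : Fin 3 → ℂ} (h : A w = v)
    {a : ℕ} {F : MvPolynomial (Fin 3) ℂ} (hF : F ∈ RingHom.ker (eval v) ^ a) :
    substLinear A F ∈ RingHom.ker (eval w) ^ a := by
  have h1 : RingHom.ker (eval v) ≤ (RingHom.ker (eval w)).comap (substLinear A) := fun G hG => by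
    rw [Ideal.mem_comap, RingHom.mem_ker, eval_substLinear, h]
    exact hG
  exact Ideal.le_comap_pow _ _ (Ideal.pow_right_mono h1 a hF)

theorem finrank_idealCompI_ker_pow_inf (A : (Fin 3 → ℂ) ≃ₗ[ℂ] (Fin 3 → ℂ)) {v v' w w' : Fin 3 → ℂ}
    (h : A w = v) (h' : A w' = v') (a b d : ℕ) :
    Module.finrank ℂ (idealCompI (RingHom.ker (eval v) ^ a ⊓ RingHom.ker (eval v') ^ b) d) =
      Module.finrank ℂ (idealCompI (RingHom.ker (eval w) ^ a ⊓ RingHom.ker (eval w') ^ b) d) := by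
  let S := MvPolynomial (Fin 3) ℂ
  let I : Submodule ℂ S := idealCompI (RingHom.ker (eval v) ^ a ⊓ RingHom.ker (eval v') ^ b) d
  let J : Submodule ℂ S := idealCompI (RingHom.ker (eval w) ^ a ⊓ RingHom.ker (eval w') ^ b) d
  have hIJ : ∀ F ∈ I, substLinear A F ∈ J := fun F hF =>
    ⟨substLinear_isHomogeneous A hF.1, substLinear_mem_ker_pow A h hF.2.1,
      substLinear_mem_ker_pow A h' hF.2.2⟩
  have hJI : ∀ F ∈ J, substLinear A.symm F ∈ I := fun F hF =>
    ⟨substLinear_isHomogeneous A.symm hF.1,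
      substLinear_mem_ker_pow A.symm (by rw [← h, A.symm_apply_apply]) hF.2.1,
      substLinear_mem_ker_pow A.symm (by rw [← h', A.symm_apply_apply]) hF.2.2⟩
  exact LinearEquiv.finrank_eq (LinearEquiv.ofLinearMap
    ((substLinear A).toLinearMap.restrict hIJ) ((substLinear A.symm).toLinearMap.restrict hJI)
    (LinearMap.ext fun F => Subtype.ext (substLinear_symm_substLinear A.symm F))
    (LinearMap.ext fun F => Subtype.ext (substLinear_symm_substLinear A F)))

theorem exists_linearEquiv_single_eq_rep {P Q : P2} (h : P ≠ Q) :
    ∃ A : (Fin 3 → ℂ) ≃ₗ[ℂ] (Fin 3 → ℂ),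
      A (Pi.single 0 1) = P.rep ∧ A (Pi.single 1 1) = Q.rep := by
  obtain ⟨x, hx⟩ := exists_linearIndependent_snoc_of_lt_rank
    (Projectivization.linearIndependent_pair_iff_ne.mpr h)
    (by rw [← Module.finrank_eq_rank, Module.finrank_fin_fun]; norm_num)
  let b := basisOfLinearIndependentOfCardEqFinrank hx (by simp)
  have hA : ∀ i, (Pi.basisFun ℂ (Fin 3)).equiv b (Equiv.refl _) (Pi.single i 1) = b i := fun i => by
    rw [← Pi.basisFun_apply, Module.Basis.equiv_apply, Equiv.refl_apply]
  refine ⟨(Pi.basisFun ℂ (Fin 3)).equiv b (Equiv.refl _), ?_, ?_⟩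
  · rw [hA, coe_basisOfLinearIndependentOfCardEqFinrank]
    exact Fin.snoc_castSucc (α := fun _ => Fin 3 → ℂ) x ![P.rep, Q.rep] 0
  · rw [hA, coe_basisOfLinearIndependentOfCardEqFinrank]
    exact Fin.snoc_castSucc (α := fun _ => Fin 3 → ℂ) x ![P.rep, Q.rep] 1

theorem degree_erase_add (e : Fin 3 →₀ ℕ) (i : Fin 3) : (e.erase i).degree + e i = e.degree := by
  conv_rhs => rw [← Finsupp.erase_add_single i e]
  rw [map_add, Finsupp.degree_single]

theorem monomial_mem_ker_eval_single_pow (i : Fin 3) {a : ℕ} {e : Fin 3 →₀ ℕ}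
    (h : e i + a ≤ e.degree) (c : ℂ) :
    monomial e c ∈ RingHom.ker (eval (Pi.single i 1 : Fin 3 → ℂ)) ^ a := by
  have h1 : ∏ j ∈ Finset.univ.erase i, (X j : MvPolynomial (Fin 3) ℂ) ^ e j ∈
      ∏ j ∈ Finset.univ.erase i, RingHom.ker (eval (Pi.single i 1 : Fin 3 → ℂ)) ^ e j :=
    Ideal.prod_mem_prod fun j hj => Ideal.pow_mem_pow (by
      simp [RingHom.mem_ker, Finset.ne_of_mem_erase hj]) _
  rw [Finset.prod_pow_eq_pow_sum] at h1
  rw [Finsupp.degree_eq_sum, ← Finset.add_sum_erase _ _ (Finset.mem_univ i)] at h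
  have h2 := Ideal.pow_le_pow_right (Nat.le_of_add_le_add_left h) h1
  rw [monomial_eq, Finsupp.prod_fintype _ _ (by simp),
    ← Finset.mul_prod_erase _ _ (Finset.mem_univ i)]
  exact Ideal.mul_mem_left _ _ (Ideal.mul_mem_left _ _ h2)

theorem mem_ker_eval_single_pow_iff (i : Fin 3) {a d : ℕ} {G : MvPolynomial (Fin 3) ℂ}
    (hG : G.IsHomogeneous d) :
    G ∈ RingHom.ker (eval (Pi.single i 1 : Fin 3 → ℂ)) ^ a ↔ ∀ e ∈ G.support, e i + a ≤ d := by
  have hdeg : ∀ e ∈ G.support, e.degree = d := fun e he => by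
    rw [Finsupp.degree_apply, ← hG.degree_eq_sum_deg_support he]
  constructor
  · intro h e he
    let σ : MvPolynomial (Fin 3) ℂ →ₐ[ℂ] MvPolynomial (Fin 3) ℂ :=
      aeval fun j => if j = i then 1 else X j
    have hσ : ∀ e c, σ (monomial e c) = monomial (e.erase i) c := by
      intro e c
      rw [monomial_eq, monomial_eq, Finsupp.prod_fintype _ _ (by simp),
        Finsupp.prod_fintype _ _ (by simp), ← Finset.mul_prod_erase _ _ (Finset.mem_univ i),
        ← Finset.mul_prod_erase _ (fun j => X j ^ (e.erase i) j) (Finset.mem_univ i)]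
      simp only [map_mul, map_prod, map_pow, σ, aeval_X, if_true, one_pow, Finsupp.erase_same,
        pow_zero, algHom_C, algebraMap_eq]
      congr 2
      refine Finset.prod_congr rfl fun j hj => ?_
      rw [if_neg (Finset.ne_of_mem_erase hj), Finsupp.erase_ne (Finset.ne_of_mem_erase hj)]
    have heval : constantCoeff.comp σ.toRingHom = eval (Pi.single i 1 : Fin 3 → ℂ) := by
      ext j
      · simp
      · rcases eq_or_ne j i with rfl | hj
        · simp [σ]
        · simp [σ, hj]
    have hker : RingHom.ker (eval (Pi.single i 1 : Fin 3 → ℂ)) ≤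
        (idealOfVars (Fin 3) ℂ).comap σ := by
      intro F hF
      rw [Ideal.mem_comap, ← pow_one (idealOfVars (Fin 3) ℂ), mem_pow_idealOfVars_iff']
      intro x hx
      obtain rfl : x = 0 := (Finsupp.degree_eq_zero_iff x).mp (by omega)
      exact (RingHom.congr_fun heval F).trans hF
    have h1 : σ G ∈ idealOfVars (Fin 3) ℂ ^ a :=
      Ideal.le_comap_pow _ _ (Ideal.pow_right_mono hker a h)
    rw [mem_pow_idealOfVars_iff'] at h1
    have h2 : coeff (e.erase i) (σ G) = coeff e G := by
      conv_lhs => rw [G.as_sum, map_sum, coeff_sum]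
      rw [Finset.sum_eq_single_of_mem e he]
      · rw [hσ, coeff_monomial, if_pos rfl]
      · intro f hf hfe
        rw [hσ, coeff_monomial, if_neg]
        intro hef
        apply hfe
        have h3 := degree_erase_add e i
        have h4 := degree_erase_add f i
        rw [hdeg e he] at h3
        rw [hdeg f hf, hef] at h4
        rw [← Finsupp.erase_add_single i e, ← Finsupp.erase_add_single i f, hef,
          show f i = e i by omega]
    by_contra hlt
    have h3 := degree_erase_add e i
    rw [hdeg e he] at h3
    rw [h1 _ (by omega)] at h2
    exact mem_support_iff.mp he h2.symm
  · intro h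
    rw [G.as_sum]
    refine Ideal.sum_mem _ fun e he => monomial_mem_ker_eval_single_pow i ?_ _
    rw [hdeg e he]
    exact h e he

theorem finrank_idealCompI_pointIdeal_pow_inf {P Q : P2} (h : P ≠ Q) (a b d : ℕ) :
    Module.finrank ℂ (idealCompI (pointIdeal P ^ a ⊓ pointIdeal Q ^ b) d) =
      Nat.card {k : IncPair (d + 2) // (k.1.1 : ℕ) + a ≤ d ∧ b + 1 ≤ (k.1.2 : ℕ)} := by
  obtain ⟨A, hP, hQ⟩ := exists_linearEquiv_single_eq_rep h
  rw [pointIdeal, pointIdeal, finrank_idealCompI_ker_pow_inf A hP hQ, ← natCard_exponents_eq,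
    ← finrank_restrictSupport]
  have h1 : idealCompI (RingHom.ker (eval (Pi.single 0 1)) ^ a ⊓
      RingHom.ker (eval (Pi.single 1 1)) ^ b) d =
      restrictSupport ℂ {e | e.degree = d ∧ e 0 + a ≤ d ∧ e 1 + b ≤ d} := by
    ext F
    rw [mem_restrictSupport_iff]
    constructor
    · rintro ⟨hF, h0, h1⟩ e he
      have hF' : F.IsHomogeneous d := hF
      exact ⟨(hF'.degree_eq_sum_deg_support he).symm,
        (mem_ker_eval_single_pow_iff 0 hF').mp h0 e he,
        (mem_ker_eval_single_pow_iff 1 hF').mp h1 e he⟩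
    · intro hF
      have hF' : F.IsHomogeneous d := by
        rw [← mem_homogeneousSubmodule, homogeneousSubmodule_eq_finsupp_supported]
        exact fun e he => (hF he).1
      exact ⟨hF', (mem_ker_eval_single_pow_iff 0 hF').mpr fun e he => (hF he).2.1,
        (mem_ker_eval_single_pow_iff 1 hF').mpr fun e he => (hF he).2.2⟩
  rw [h1]

theorem HF_eq_HFI_of_tangentLine (T : (Fin 3 → ℂ) ≃ₗ[ℂ] (Fin 3 → ℂ)) {r s : ℕ} (hr : 2 ≤ r)
    (hs : 2 ≤ s) (t : Fin r ⊕ Fin s → ℂ × ℂ) (ht0 : ∀ i, t i ≠ 0)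
    (ht : Pairwise fun i j => bracket (t i) (t j) ≠ 0) {P Q : P2} (hPQ : P ≠ Q) (d : ℕ) :
    HF (starConfig (fun i => tangentLine T (t (Sum.inl i))) ∪
        starConfig fun j => tangentLine T (t (Sum.inr j))) d =
      HFI (pointIdeal P ^ (r - 1) ⊓ pointIdeal Q ^ (s - 1)) d := by
  rw [HF, HFI, finrank_idealComp_union_starConfig T t ht0 ht,
    finrank_idealCompI_pointIdeal_pow_inf hPQ]
  congr 2
  refine Nat.card_congr (Equiv.subtypeEquivRight fun k => ?_)
  omega

/-- **Two contact star configurations have the h-vector of two fat points.**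
Let `γ` be an irreducible conic and `ℓ₁,…,ℓ_r, m₁,…,m_s` pairwise distinct lines tangent
to `γ`, `r, s ≥ 2`, with contact star configurations `X` and `Y`.  Let `P ≠ Q` be points
of `ℙ²` and `Z = (r−1)P + (s−1)Q` the fat point scheme with
`I_Z = I_P^{r−1} ∩ I_Q^{s−1}`.  Then `h_{X∪Y}(d) = h_Z(d)` for all `d ≥ 0`. -/
theorem hvector_two_contact_stars_eq_two_fat_points
    (γ : Set P2) (hγ : IsIrredConic γ) (r s : ℕ) (hr : 2 ≤ r) (hs : 2 ≤ s)
    (ℓ : Fin r → Set P2) (m : Fin s → Set P2)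
    (hℓline : ∀ i, IsLine (ℓ i)) (hmline : ∀ j, IsLine (m j))
    (hℓtan : ∀ i, IsTangent (ℓ i) γ) (hmtan : ∀ j, IsTangent (m j) γ)
    (hℓinj : Function.Injective ℓ) (hminj : Function.Injective m)
    (hcross : ∀ i j, ℓ i ≠ m j)
    (P Q : P2) (hPQ : P ≠ Q) :
    ∀ d : ℕ, hvec (starConfig ℓ ∪ starConfig m) d =
      hvecI (pointIdeal P ^ (r - 1) ⊓ pointIdeal Q ^ (s - 1)) d := by
  obtain ⟨q, hq, hirr, rfl⟩ := hγ
  obtain ⟨T, hT⟩ := exists_conic_coordinates hq hirr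
  choose u hu0 hu using fun i => exists_eq_tangentLine T hT (hℓline i) (hℓtan i)
  choose v hv0 hv using fun j => exists_eq_tangentLine T hT (hmline j) (hmtan j)
  obtain rfl : ℓ = fun i => tangentLine T (u i) := _root_.funext hu
  obtain rfl : m = fun j => tangentLine T (v j) := _root_.funext hv
  have ht0 : ∀ i, Sum.elim u v i ≠ 0 := by
    rintro (i | j)
    · exact hu0 i
    · exact hv0 j
  have ht : Pairwise fun i j => bracket (Sum.elim u v i) (Sum.elim u v j) ≠ 0 := by
    intro i j hij h
    have h1 := tangentLine_eq_of_bracket_eq_zero T (ht0 i) (ht0 j) h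
    rcases i with i | i <;> rcases j with j | j
    · exact hij (congrArg Sum.inl (hℓinj h1))
    · exact hcross i j h1
    · exact hcross j i h1.symm
    · exact hij (congrArg Sum.inr (hminj h1))
  have key := HF_eq_HFI_of_tangentLine T hr hs (Sum.elim u v) ht0 ht hPQ
  rintro (_ | d)
  · exact key 0
  · exact congrArg₂ (· - ·) (key (d + 1)) (key d)
end
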